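/- Let B ≥ 1 and let u, v, a be positive natural numbers with gcd(a, v) = 1. Suppose every prime divisor of gcd(u, v) exceeds B. Let r = (a·u) mod v, and let s be the largest divisor of r all of whose prime factors exceed B (i.e., r with all prime factors p ≤ B removed; take s = 0 if r = 0). Then gcd(v, s) = gcd(u, v). -/

import Mathlib

/-- `removeSmall B r` is `r` with all prime factors `p ≤ B` removed, i.e. the largest
divisor of `r` all of whose prime factors exceed `B`; by convention it is `0` when `r = 0`. -/
def removeSmall (B r : ℕ) : ℕ :=
  if r = 0 then 0
  else ∏ p ∈ r.primeFactors.filter (fun p => B < p), p ^ r.factorization p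

theorem removeSmall_mul_prod_small {r : ℕ} (B : ℕ) (hr : r ≠ 0) :
    removeSmall B r * ∏ p ∈ r.primeFactors.filter (fun p => ¬ B < p), p ^ r.factorization p = r := by
  rw [removeSmall, if_neg hr, Finset.prod_filter_mul_prod_filter_not]
  exact Nat.prod_factorization_pow_eq_self hr

theorem removeSmall_dvd (B r : ℕ) : removeSmall B r ∣ r := by
  rcases eq_or_ne r 0 with rfl | hr
  · exact dvd_zero _
  · exact Dvd.intro _ (removeSmall_mul_prod_small B hr)

theorem dvd_removeSmall {B r g : ℕ} (hg : g ∣ r) (hbig : ∀ p : ℕ, p.Prime → p ∣ g → B < p) :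
    g ∣ removeSmall B r := by
  rcases eq_or_ne r 0 with rfl | hr
  · simp [removeSmall]
  · rw [← removeSmall_mul_prod_small B hr] at hg
    refine Nat.Coprime.dvd_of_dvd_mul_right (Nat.Coprime.prod_right fun p hp => ?_) hg
    obtain ⟨hpr, hpB⟩ := Finset.mem_filter.mp hp
    have hprime := Nat.prime_of_mem_primeFactors hpr
    refine Nat.Coprime.pow_right _ (Nat.Coprime.symm ?_)
    exact hprime.coprime_iff_not_dvd.mpr fun h => hpB (hbig p hprime h)

theorem stmt4 (B u v a : ℕ) (hB : 1 ≤ B) (hu : 0 < u) (hv : 0 < v) (ha : 0 < a)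
    (hcop : Nat.gcd a v = 1)
    (hbig : ∀ p : ℕ, p.Prime → p ∣ Nat.gcd u v → B < p) :
    Nat.gcd v (removeSmall B ((a * u) % v)) = Nat.gcd u v := by
  have hgcd : Nat.gcd v ((a * u) % v) = Nat.gcd u v := by
    rw [Nat.gcd_comm, ← Nat.gcd_rec, Nat.gcd_comm]
    exact Nat.Coprime.gcd_mul_left_cancel u hcop
  apply Nat.dvd_antisymm
  · rw [← hgcd]
    exact Nat.gcd_dvd_gcd_of_dvd_right v (removeSmall_dvd B _)
  · refine Nat.dvd_gcd (Nat.gcd_dvd_right u v) (dvd_removeSmall ?_ hbig)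
    rw [← hgcd]
    exact Nat.gcd_dvd_right _ _
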